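/- Let X, Y_1, ..., Y_n be independent discrete random variables taking finitely many values in a commutative group, and suppose H(X + Y_j) ≤ H(X) + log K_j for some constants K_1, ..., K_n ≥ 1. Then H(X + Y_1 + ... + Y_n) ≤ H(X) + log(K_1 K_2 ⋯ K_n). -/

import Mathlib

/-- The probability of the event `E` under the probability mass function `p`
on a finite sample space. -/
noncomputable def prob {Ω : Type*} [Fintype Ω] (p : Ω → ℝ) (E : Set Ω) : ℝ :=
  ∑ ω, E.indicator p ω

/-- The Shannon entropy (base 2) of the discrete random variable `X` on the finite
probability space given by the probability mass function `p`. -/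
noncomputable def ent {Ω S : Type*} [Fintype Ω] (p : Ω → ℝ) (X : Ω → S) : ℝ :=
  letI := Classical.decEq S
  ∑ v ∈ Finset.univ.image X,
      -(prob p {ω | X ω = v} * Real.logb 2 (prob p {ω | X ω = v}))

section helpers

open Classical in
theorem prob_eq_ite {Ω : Type*} [Fintype Ω] (p : Ω → ℝ) (P : Ω → Prop) :
    prob p {ω | P ω} = ∑ ω, if P ω then p ω else 0 := by
  unfold prob
  refine Finset.sum_congr rfl fun ω _ => ?_
  simp [Set.indicator_apply]

theorem prob_nonneg' {Ω : Type*} [Fintype Ω] {p : Ω → ℝ} (hp : ∀ ω, 0 ≤ p ω) (E : Set Ω) :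
    0 ≤ prob p E :=
  Finset.sum_nonneg fun ω _ => Set.indicator_nonneg (fun ω _ => hp ω) ω

theorem prob_pos' {Ω : Type*} [Fintype Ω] {p : Ω → ℝ} (hp : ∀ ω, 0 ≤ p ω) {E : Set Ω}
    {ω : Ω} (hω : 0 < p ω) (hE : ω ∈ E) : 0 < prob p E := by
  refine Finset.sum_pos' (fun ω _ => Set.indicator_nonneg (fun ω _ => hp ω) ω)
    ⟨ω, Finset.mem_univ _, ?_⟩
  rwa [Set.indicator_of_mem hE]

open Classical in
/-- Marginalisation. -/
theorem prob_marg {Ω S : Type*} [Fintype Ω] (p : Ω → ℝ) (P : Ω → Prop) (Z : Ω → S) :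
    ∑ z ∈ Finset.univ.image Z, prob p {ω | P ω ∧ Z ω = z} = prob p {ω | P ω} := by
  simp only [prob_eq_ite]
  rw [Finset.sum_comm]
  refine Finset.sum_congr rfl fun ω _ => ?_
  by_cases h : P ω
  · simp [h]
  · simp [h]

open Classical in
theorem prob_marg_one {Ω S : Type*} [Fintype Ω] {p : Ω → ℝ} (hp1 : ∑ ω, p ω = 1) (Z : Ω → S) :
    ∑ z ∈ Finset.univ.image Z, prob p {ω | Z ω = z} = 1 := by
  have := prob_marg p (fun _ => True) Z
  simp only [true_and] at this
  rw [this, prob_eq_ite]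
  simpa using hp1

theorem sum_comp_eq {Ω S : Type*} [Fintype Ω] [DecidableEq S] (p : Ω → ℝ) (Z : Ω → S) (f : S → ℝ) :
    ∑ ω, p ω * f (Z ω) = ∑ z ∈ Finset.univ.image Z, prob p {ω | Z ω = z} * f z := by
  simp only [prob_eq_ite, Finset.sum_mul]
  rw [Finset.sum_comm]
  refine Finset.sum_congr rfl fun ω _ => ?_
  simp

theorem ent_eq {Ω S : Type*} [Fintype Ω] (p : Ω → ℝ) (X : Ω → S) :
    ent p X = -∑ ω, p ω * Real.logb 2 (prob p {ω' | X ω' = X ω}) := by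
  letI := Classical.decEq S
  rw [sum_comp_eq p X (fun v => Real.logb 2 (prob p {ω' | X ω' = v}))]
  unfold ent
  rw [Finset.sum_neg_distrib]

theorem ent_congr {Ω S T : Type*} [Fintype Ω] (p : Ω → ℝ) (X : Ω → S) (Y : Ω → T)
    (h : ∀ ω ω', X ω' = X ω ↔ Y ω' = Y ω) : ent p X = ent p Y := by
  simp only [ent_eq, h]

/-- Pairwise independence. -/
def Ind {Ω S T : Type*} [Fintype Ω] (p : Ω → ℝ) (A : Ω → S) (B : Ω → T) : Prop :=
  ∀ a b, prob p {ω | A ω = a ∧ B ω = b} = prob p {ω | A ω = a} * prob p {ω | B ω = b}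

theorem Ind.symm' {Ω S T : Type*} [Fintype Ω] {p : Ω → ℝ} {A : Ω → S} {B : Ω → T}
    (h : Ind p A B) : Ind p B A := by
  intro b a
  have := h a b
  simp only [and_comm] at this ⊢
  rw [this, mul_comm]

theorem Ind.comp_left {Ω S T U : Type*} [Fintype Ω] {p : Ω → ℝ} {A : Ω → S} {B : Ω → T}
    (h : Ind p A B) (f : S → U) : Ind p (fun ω => f (A ω)) B := by
  classical
  intro u b
  rw [← prob_marg p (fun ω => f (A ω) = u ∧ B ω = b) A,
    ← prob_marg p (fun ω => f (A ω) = u) A, Finset.sum_mul]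
  refine Finset.sum_congr rfl fun a _ => ?_
  by_cases hf : f a = u
  · have e1 : ∀ ω, ((f (A ω) = u ∧ B ω = b) ∧ A ω = a) ↔ (A ω = a ∧ B ω = b) := by
      intro ω; constructor
      · tauto
      · rintro ⟨rfl, h⟩; exact ⟨⟨hf, h⟩, rfl⟩
    have e2 : ∀ ω, (f (A ω) = u ∧ A ω = a) ↔ A ω = a := by
      intro ω; constructor
      · tauto
      · rintro rfl; exact ⟨hf, rfl⟩
    simp only [e1, e2]
    exact h a b
  · have e1 : ∀ ω, ¬ ((f (A ω) = u ∧ B ω = b) ∧ A ω = a) := by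
      rintro ω ⟨⟨h1, _⟩, rfl⟩; exact hf h1
    have e2 : ∀ ω, ¬ (f (A ω) = u ∧ A ω = a) := by
      rintro ω ⟨h1, rfl⟩; exact hf h1
    simp only [prob_eq_ite, e1, e2]
    simp

theorem Ind.comp_right {Ω S T U : Type*} [Fintype Ω] {p : Ω → ℝ} {A : Ω → S} {B : Ω → T}
    (h : Ind p A B) (f : T → U) : Ind p A (fun ω => f (B ω)) :=
  (h.symm'.comp_left f).symm'

theorem ent_pair {Ω S T : Type*} [Fintype Ω] {p : Ω → ℝ} (hp : ∀ ω, 0 ≤ p ω)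
    {A : Ω → S} {B : Ω → T} (h : Ind p A B) :
    ent p (fun ω => (A ω, B ω)) = ent p A + ent p B := by
  simp only [ent_eq, Prod.mk.injEq]
  rw [← neg_add, ← Finset.sum_add_distrib]
  congr 1
  refine Finset.sum_congr rfl fun ω _ => ?_
  rcases (hp ω).eq_or_lt with h0 | h0
  · simp [← h0]
  · rw [h (A ω) (B ω), Real.logb_mul, mul_add]
    · exact (prob_pos' hp h0 (by simp)).ne'
    · exact (prob_pos' hp h0 (by simp)).ne'

theorem ratio_sum_le {Ω S T U : Type*} [Fintype Ω] {p : Ω → ℝ} (hp : ∀ ω, 0 ≤ p ω)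
    (hp1 : ∑ ω, p ω = 1) (A : Ω → S) (B : Ω → T) (C : Ω → U) :
    ∑ ω, p ω * (prob p {ω' | C ω' = C ω ∧ A ω' = A ω} * prob p {ω' | C ω' = C ω ∧ B ω' = B ω} /
      (prob p {ω' | (A ω', B ω', C ω') = (A ω, B ω, C ω)} * prob p {ω' | C ω' = C ω})) ≤ 1 := by
  classical
  rw [sum_comp_eq p (fun ω => (A ω, B ω, C ω)) (fun t =>
    prob p {ω' | C ω' = t.2.2 ∧ A ω' = t.1} * prob p {ω' | C ω' = t.2.2 ∧ B ω' = t.2.1} /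
      (prob p {ω' | (A ω', B ω', C ω') = t} * prob p {ω' | C ω' = t.2.2}))]
  have hn := fun E => prob_nonneg' hp E
  calc _ ≤ ∑ t ∈ Finset.univ.image (fun ω => (A ω, B ω, C ω)),
        prob p {ω' | C ω' = t.2.2 ∧ A ω' = t.1} * prob p {ω' | C ω' = t.2.2 ∧ B ω' = t.2.1} /
          prob p {ω' | C ω' = t.2.2} := by
        refine Finset.sum_le_sum fun t _ => ?_
        rcases (hn {ω' | (A ω', B ω', C ω') = t}).eq_or_lt with h0 | h0
        · rw [← h0, zero_mul]
          exact div_nonneg (mul_nonneg (hn _) (hn _)) (hn _)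
        · rw [← mul_div_assoc, mul_div_mul_left _ _ h0.ne']
    _ ≤ ∑ t ∈ Finset.univ.image A ×ˢ (Finset.univ.image B ×ˢ Finset.univ.image C),
        prob p {ω' | C ω' = t.2.2 ∧ A ω' = t.1} * prob p {ω' | C ω' = t.2.2 ∧ B ω' = t.2.1} /
          prob p {ω' | C ω' = t.2.2} := by
        refine Finset.sum_le_sum_of_subset_of_nonneg ?_ fun t _ _ =>
          div_nonneg (mul_nonneg (hn _) (hn _)) (hn _)
        intro t ht
        simp only [Finset.mem_image, Finset.mem_univ, true_and] at ht
        obtain ⟨ω, rfl⟩ := ht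
        simp
    _ = ∑ c ∈ Finset.univ.image C, ∑ a ∈ Finset.univ.image A, ∑ b ∈ Finset.univ.image B,
        prob p {ω' | C ω' = c ∧ A ω' = a} * prob p {ω' | C ω' = c ∧ B ω' = b} /
          prob p {ω' | C ω' = c} := by
        rw [Finset.sum_product, Finset.sum_comm]
        rw [Finset.sum_product, Finset.sum_comm]
        refine Finset.sum_congr rfl fun c _ => ?_
        rw [Finset.sum_comm]
    _ = ∑ c ∈ Finset.univ.image C, prob p {ω' | C ω' = c} := by
        refine Finset.sum_congr rfl fun c _ => ?_
        simp only [← Finset.sum_div, ← Finset.mul_sum, ← Finset.sum_mul]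
        rw [prob_marg p (fun ω => C ω = c) A, prob_marg p (fun ω => C ω = c) B]
        exact mul_self_div_self _
    _ = 1 := prob_marg_one hp1 C
    _ ≤ 1 := le_rfl

theorem ent_submod {Ω S T U : Type*} [Fintype Ω] {p : Ω → ℝ} (hp : ∀ ω, 0 ≤ p ω)
    (hp1 : ∑ ω, p ω = 1) (A : Ω → S) (B : Ω → T) (C : Ω → U) :
    ent p (fun ω => (A ω, B ω, C ω)) + ent p C ≤
      ent p (fun ω => (C ω, A ω)) + ent p (fun ω => (C ω, B ω)) := by
  have key := ratio_sum_le hp hp1 A B C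
  simp only [ent_eq]
  simp only [Prod.mk.injEq] at key ⊢
  rw [← neg_add, ← neg_add, neg_le_neg_iff, ← sub_nonpos, ← Finset.sum_add_distrib,
    ← Finset.sum_add_distrib, ← Finset.sum_sub_distrib]
  have hl : 0 < Real.log 2 := Real.log_pos (by norm_num)
  have : ∀ ω, p ω * Real.logb 2 (prob p {ω' | C ω' = C ω ∧ A ω' = A ω}) +
      p ω * Real.logb 2 (prob p {ω' | C ω' = C ω ∧ B ω' = B ω}) -
      (p ω * Real.logb 2 (prob p {ω' | A ω' = A ω ∧ B ω' = B ω ∧ C ω' = C ω}) +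
      p ω * Real.logb 2 (prob p {ω' | C ω' = C ω})) ≤
      (p ω * (prob p {ω' | C ω' = C ω ∧ A ω' = A ω} * prob p {ω' | C ω' = C ω ∧ B ω' = B ω} /
      (prob p {ω' | A ω' = A ω ∧ B ω' = B ω ∧ C ω' = C ω} * prob p {ω' | C ω' = C ω})) - p ω)
        / Real.log 2 := by
    intro ω
    rcases (hp ω).eq_or_lt with h0 | h0
    · simp [← h0]
    have h1 : 0 < prob p {ω' | C ω' = C ω ∧ A ω' = A ω} := prob_pos' hp h0 (by simp)
    have h2 : 0 < prob p {ω' | C ω' = C ω ∧ B ω' = B ω} := prob_pos' hp h0 (by simp)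
    have h3 : 0 < prob p {ω' | A ω' = A ω ∧ B ω' = B ω ∧ C ω' = C ω} :=
      prob_pos' hp h0 (by simp)
    have h4 : 0 < prob p {ω' | C ω' = C ω} := prob_pos' hp h0 (by simp)
    generalize prob p {ω' | C ω' = C ω ∧ A ω' = A ω} = a at *
    generalize prob p {ω' | C ω' = C ω ∧ B ω' = B ω} = b at *
    generalize prob p {ω' | A ω' = A ω ∧ B ω' = B ω ∧ C ω' = C ω} = c at *
    generalize prob p {ω' | C ω' = C ω} = d at *
    have hlog := Real.log_le_sub_one_of_pos (show 0 < a * b / (c * d) by positivity)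
    rw [Real.log_div (by positivity) (by positivity), Real.log_mul h1.ne' h2.ne',
      Real.log_mul h3.ne' h4.ne'] at hlog
    rw [le_div_iff₀ hl]
    simp only [Real.logb]
    have := mul_le_mul_of_nonneg_left hlog h0.le
    calc _ = p ω * (Real.log a + Real.log b - (Real.log c + Real.log d)) := by
          field_simp
      _ ≤ _ := this
      _ = _ := by ring
  refine (Finset.sum_le_sum fun ω _ => this ω).trans ?_
  rw [← Finset.sum_div, Finset.sum_sub_distrib, hp1]
  exact div_nonpos_of_nonpos_of_nonneg (by linarith) hl.le

/-- The three-variable inequality. -/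
theorem ent_three {Ω G : Type*} [Fintype Ω] [AddCommGroup G] {p : Ω → ℝ} (hp : ∀ ω, 0 ≤ p ω)
    (hp1 : ∑ ω, p ω = 1) (X S Y : Ω → G) (h1 : Ind p Y (fun ω => (X ω, S ω)))
    (h2 : Ind p X S) :
    ent p (fun ω => X ω + S ω + Y ω) + ent p X ≤
      ent p (fun ω => X ω + S ω) + ent p (fun ω => X ω + Y ω) := by
  have h3 : Ind p Y X := h1.comp_right Prod.fst
  have h4 : Ind p S (fun ω => (X ω, Y ω)) := by
    rintro s ⟨x, y⟩
    have e1 := h1 y (x, s)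
    have e2 := h2 x s
    have e3 := h3 y x
    have c1 : ∀ ω, (S ω = s ∧ (X ω, Y ω) = (x, y)) ↔ (Y ω = y ∧ (X ω, S ω) = (x, s)) := by
      intro ω; simp only [Prod.mk.injEq]; tauto
    have c2 : ∀ ω, (X ω, Y ω) = (x, y) ↔ (Y ω = y ∧ X ω = x) := by
      intro ω; simp only [Prod.mk.injEq]; tauto
    have c3 : ∀ ω, (X ω, S ω) = (x, s) ↔ (X ω = x ∧ S ω = s) := by
      intro ω; simp only [Prod.mk.injEq]
    rw [show {ω | S ω = s ∧ (X ω, Y ω) = (x, y)} = {ω | Y ω = y ∧ (X ω, S ω) = (x, s)} from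
      Set.ext c1, e1, show {ω | (X ω, Y ω) = (x, y)} = {ω | Y ω = y ∧ X ω = x} from
      Set.ext c2, e3, show {ω | (X ω, S ω) = (x, s)} = {ω | X ω = x ∧ S ω = s} from
      Set.ext c3, e2]
    ring
  have sm := ent_submod hp hp1 Y S (fun ω => X ω + S ω + Y ω)
  have t1 : ent p (fun ω => (Y ω, S ω, X ω + S ω + Y ω)) = ent p Y + (ent p X + ent p S) := by
    rw [← ent_pair hp h2, ← ent_pair hp h1]
    apply ent_congr
    intro ω ω'
    simp only [Prod.mk.injEq]
    constructor
    · rintro ⟨a, b, c⟩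
      rw [a, b] at c
      exact ⟨a, by simpa using c, b⟩
    · rintro ⟨a, b, c⟩
      simp [a, b, c]
  have t2 : ent p (fun ω => (X ω + S ω + Y ω, Y ω)) = ent p Y + ent p (fun ω => X ω + S ω) := by
    rw [← ent_pair hp (h1.comp_right (fun t : G × G => t.1 + t.2))]
    apply ent_congr
    intro ω ω'
    simp only [Prod.mk.injEq]
    constructor
    · rintro ⟨a, b⟩
      rw [b] at a
      exact ⟨b, by simpa using a⟩
    · rintro ⟨a, b⟩
      simp [a, b]
  have t3 : ent p (fun ω => (X ω + S ω + Y ω, S ω)) = ent p S + ent p (fun ω => X ω + Y ω) := by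
    rw [← ent_pair hp (h4.comp_right (fun t : G × G => t.1 + t.2))]
    apply ent_congr
    intro ω ω'
    simp only [Prod.mk.injEq, add_right_comm _ (S _)]
    constructor
    · rintro ⟨a, b⟩
      rw [b] at a
      exact ⟨b, by simpa using a⟩
    · rintro ⟨a, b⟩
      simp [a, b]
  linarith

end helpers

theorem entropy_plunnecke_ruzsa_iterated {Ω G : Type*} [Fintype Ω] [AddCommGroup G]
    (n : ℕ) (p : Ω → ℝ) (hp : ∀ ω, 0 ≤ p ω) (hp1 : ∑ ω, p ω = 1)
    (X : Ω → G) (Y : Fin n → Ω → G) (K : Fin n → ℝ) (hK : ∀ j, 1 ≤ K j)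
    (hindep : ∀ (x : G) (y : Fin n → G),
      prob p {ω | X ω = x ∧ ∀ j, Y j ω = y j} =
        prob p {ω | X ω = x} * ∏ j, prob p {ω | Y j ω = y j})
    (hH : ∀ j, ent p (fun ω => X ω + Y j ω) ≤ ent p X + Real.logb 2 (K j)) :
    ent p (fun ω => X ω + ∑ j, Y j ω) ≤ ent p X + Real.logb 2 (∏ j, K j) := by
  classical
  induction n with
  | zero => simp
  | succ n ih =>
    have hm : ∀ (x : G) (y : Fin n → G),
        prob p {ω | X ω = x ∧ ∀ j : Fin n, Y j.castSucc ω = y j} =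
        prob p {ω | X ω = x} * ∏ j : Fin n, prob p {ω | Y j.castSucc ω = y j} := by
      intro x y
      rw [← prob_marg p (fun ω => X ω = x ∧ ∀ j : Fin n, Y j.castSucc ω = y j) (Y (Fin.last n))]
      have : ∀ z, prob p {ω | (X ω = x ∧ ∀ j : Fin n, Y j.castSucc ω = y j) ∧
          Y (Fin.last n) ω = z} = prob p {ω | X ω = x} *
          (∏ j : Fin n, prob p {ω | Y j.castSucc ω = y j}) * prob p {ω | Y (Fin.last n) ω = z} := by
        intro z
        have := hindep x (Fin.snoc (α := fun _ => G) y z)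
        simp only [Fin.forall_fin_succ', Fin.prod_univ_castSucc, Fin.snoc_castSucc,
          Fin.snoc_last] at this
        simp only [and_assoc]
        rw [this, mul_assoc]
      simp only [this]
      rw [← Finset.mul_sum, prob_marg_one hp1, mul_one]
    have hS : ∀ y : Fin n → G, prob p {ω | ∀ j : Fin n, Y j.castSucc ω = y j} =
        ∏ j : Fin n, prob p {ω | Y j.castSucc ω = y j} := by
      intro y
      rw [← prob_marg p (fun ω => ∀ j : Fin n, Y j.castSucc ω = y j) X]
      simp only [and_comm (b := X _ = _), hm]
      rw [← Finset.sum_mul, prob_marg_one hp1, one_mul]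
    have i2 : Ind p X (fun ω (j : Fin n) => Y j.castSucc ω) := by
      intro x y
      simp only [funext_iff]
      rw [hm, hS]
    have i1 : Ind p (Y (Fin.last n)) (fun ω => (X ω, fun j : Fin n => Y j.castSucc ω)) := by
      rintro z ⟨x, y⟩
      simp only [Prod.mk.injEq, funext_iff]
      have := hindep x (Fin.snoc (α := fun _ => G) y z)
      simp only [Fin.forall_fin_succ', Fin.prod_univ_castSucc, Fin.snoc_castSucc,
        Fin.snoc_last] at this
      simp only [and_comm (a := Y (Fin.last n) _ = _), and_assoc]
      rw [this, hm]
      ring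
    have h3 := ent_three hp hp1 X (fun ω => ∑ j : Fin n, Y j.castSucc ω) (Y (Fin.last n))
      (i1.comp_right (fun t : G × (Fin n → G) => (t.1, ∑ j, t.2 j)))
      (i2.comp_right (fun t : Fin n → G => ∑ j, t j))
    have h4 := ih (fun j => Y j.castSucc) (fun j => K j.castSucc) (fun j => hK _) hm
      (fun j => hH _)
    have h5 := hH (Fin.last n)
    simp only [Fin.sum_univ_castSucc, Fin.prod_univ_castSucc, ← add_assoc]
    rw [Real.logb_mul (Finset.prod_ne_zero_iff.2 fun j _ => by linarith [hK j.castSucc])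
      (by linarith [hK (Fin.last n)])]
    linarith
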